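/- Let p : ℝ → ℝ be the Ghosh density, i.e. p(l) = 2πl − 8l² + 2l³ for l ∈ [0,1], p(l) = 2πl − 8l·arccos(1/l) + 8l·√(l²−1) − 2l³ − 4l for l ∈ [1,√2], and p(l) = 0 otherwise. Then the expected maximum of two independent such lengths satisfies 0.66 < ∫₀^{√2} ∫₀^{√2} max(l₁, l₂) · p(l₁) · p(l₂) dl₂ dl₁ < 0.67. (The paper computes this value as ≈ 0.663.) -/

import Mathlib

open Real intervalIntegral

/-- The Ghosh density of the length of a random segment between two independent
uniform points of the unit square. -/
noncomputable def ghoshDensity (l : ℝ) : ℝ :=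
  if 0 ≤ l ∧ l ≤ 1 then 2 * π * l - 8 * l ^ 2 + 2 * l ^ 3
  else if 1 ≤ l ∧ l ≤ Real.sqrt 2 then
    2 * π * l - 8 * l * Real.arccos (1 / l) + 8 * l * Real.sqrt (l ^ 2 - 1)
      - 2 * l ^ 3 - 4 * l
  else 0

/-- `ghoshTail s` is `p(l) / l` for the Ghosh density `p` at `l = √(1 + s²) ∈ [1, √2]`. -/
noncomputable def ghoshTail (s : ℝ) : ℝ :=
  2 * π - 8 * arctan s + 8 * s - 2 * s ^ 2 - 6

lemma hasDerivAt_ghoshTail (s : ℝ) :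
    HasDerivAt ghoshTail (-(4 * s * (1 - s) ^ 2 / (1 + s ^ 2))) s := by
  have h := (((((hasDerivAt_arctan s).const_mul 8).const_sub (2 * π)).add
    ((hasDerivAt_id s).const_mul 8)).sub ((hasDerivAt_pow 2 s).const_mul 2)).sub_const 6
  have hs : 1 + s ^ 2 ≠ 0 := by positivity
  refine h.congr_deriv ?_
  field_simp
  ring

lemma continuous_ghoshTail : Continuous ghoshTail :=
  continuous_iff_continuousAt.2 fun s => (hasDerivAt_ghoshTail s).continuousAt

lemma ghoshTail_zero : ghoshTail 0 = 2 * π - 6 := by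
  simp [ghoshTail]

lemma ghoshTail_one : ghoshTail 1 = 0 := by
  simp only [ghoshTail, arctan_one]
  ring

lemma ghoshTail_nonneg {s : ℝ} (h0 : 0 ≤ s) (h1 : s ≤ 1) : 0 ≤ ghoshTail s := by
  have h : AntitoneOn ghoshTail (Set.Ici 0) := by
    refine antitoneOn_of_deriv_nonpos (convex_Ici 0) continuous_ghoshTail.continuousOn
      (fun x _ => (hasDerivAt_ghoshTail x).differentiableAt.differentiableWithinAt) ?_
    intro x hx
    rw [interior_Ici, Set.mem_Ioi] at hx
    rw [(hasDerivAt_ghoshTail x).deriv, neg_nonpos]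
    positivity
  simpa [ghoshTail_one] using h h0 (zero_le_one' ℝ) h1

lemma one_le_sqrt_two : (1 : ℝ) ≤ √2 := by
  rw [Real.one_le_sqrt]; norm_num

/-- The Ghosh density on `[0, 1]`. -/
noncomputable def ghoshLeft (l : ℝ) : ℝ := 2 * π * l - 8 * l ^ 2 + 2 * l ^ 3

/-- The Ghosh density on `[1, √2]`. -/
noncomputable def ghoshRight (l : ℝ) : ℝ := l * ghoshTail √(l ^ 2 - 1)

lemma continuous_ghoshLeft : Continuous ghoshLeft := by
  unfold ghoshLeft; fun_prop

lemma continuous_ghoshRight : Continuous ghoshRight :=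
  continuous_id.mul (continuous_ghoshTail.comp (by fun_prop))

lemma ghoshDensity_eq_left {l : ℝ} (h0 : 0 ≤ l) (h1 : l ≤ 1) :
    ghoshDensity l = ghoshLeft l := by
  simp [ghoshDensity, ghoshLeft, h0, h1]

lemma ghoshDensity_eq_right {l : ℝ} (h1 : 1 ≤ l) (h2 : l ≤ √2) :
    ghoshDensity l = ghoshRight l := by
  rcases h1.eq_or_lt with rfl | h
  · simp [ghoshDensity, ghoshRight, ghoshTail_zero]
    ring
  · have hl : 0 < l := by linarith
    have hs : √(1 - (1 / l) ^ 2) / (1 / l) = √(l ^ 2 - 1) := by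
      have : l ^ 2 - 1 = l ^ 2 * (1 - (1 / l) ^ 2) := by field_simp
      rw [this, Real.sqrt_mul (by positivity), Real.sqrt_sq hl.le]
      field_simp
    have hsq : √(l ^ 2 - 1) ^ 2 = l ^ 2 - 1 := Real.sq_sqrt (by nlinarith)
    rw [ghoshDensity, if_neg (by simp [h]), if_pos ⟨h1, h2⟩, ghoshRight, ghoshTail, hsq,
      arccos_eq_arctan (by positivity), hs]
    ring

lemma sqrt_sq_sub_one_le_one {l : ℝ} (hl : l ∈ Set.Icc 1 √2) :
    √(l ^ 2 - 1) ≤ 1 := by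
  rw [Real.sqrt_le_one]
  nlinarith [hl.1, hl.2, Real.sq_sqrt (zero_le_two (α := ℝ))]

lemma ghoshRight_nonneg {l : ℝ} (h : l ∈ Set.Icc 1 √2) : 0 ≤ ghoshRight l :=
  mul_nonneg (by linarith [h.1]) (ghoshTail_nonneg (Real.sqrt_nonneg _) (sqrt_sq_sub_one_le_one h))

lemma integral_mul_comp_sqrt_sq_sub_one {φ Φ : ℝ → ℝ} (hφ : Continuous φ)
    (hΦ : ∀ s, HasDerivAt Φ (s * φ s) s) :
    ∫ l in (1 : ℝ)..√2, l * φ √(l ^ 2 - 1) = Φ 1 - Φ 0 := by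
  have hc : Continuous Φ := continuous_iff_continuousAt.2 fun s => (hΦ s).continuousAt
  have hcs : Continuous fun l : ℝ => √(l ^ 2 - 1) := by fun_prop
  rw [integral_eq_sub_of_hasDerivAt_of_le (f := fun l => Φ √(l ^ 2 - 1)) one_le_sqrt_two
    (hc.comp hcs).continuousOn ?_ ?_]
  · norm_num
  · intro l hl
    have hpos : 0 < l ^ 2 - 1 := by nlinarith [hl.1]
    have hs : HasDerivAt (fun l : ℝ => l ^ 2 - 1) (2 * l) l := by
      simpa using (hasDerivAt_pow 2 l).sub_const 1
    have hs0 : √(l ^ 2 - 1) ≠ 0 := (Real.sqrt_pos.2 hpos).ne'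
    refine ((hΦ _).comp l (hs.sqrt hpos.ne')).congr_deriv ?_
    field_simp
  · exact (continuous_id.mul (hφ.comp hcs)).intervalIntegrable _ _

lemma integral_ghoshRight : ∫ l in (1 : ℝ)..√2, ghoshRight l = 19 / 6 - π := by
  unfold ghoshRight
  rw [integral_mul_comp_sqrt_sq_sub_one continuous_ghoshTail (Φ := fun s =>
    (1 + s ^ 2) / 2 * ghoshTail s + (1 + s ^ 2) ^ 2 / 2 - 4 / 3 * s ^ 3)]
  · simp only [ghoshTail_one, ghoshTail_zero]
    ring
  · intro s
    have h1 : HasDerivAt (fun s : ℝ => 1 + s ^ 2) (2 * s) s := by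
      simpa using (hasDerivAt_pow 2 s).const_add 1
    refine ((((h1.div_const 2).mul (hasDerivAt_ghoshTail s)).add
      ((h1.pow 2).div_const 2)).sub ((hasDerivAt_pow 3 s).const_mul (4 / 3))).congr_deriv ?_
    have hs : 1 + s ^ 2 ≠ 0 := by positivity
    field_simp
    ring

lemma integral_sq_mul_ghoshRight :
    ∫ l in (1 : ℝ)..√2, l ^ 2 * ghoshRight l = 8 / 5 - π / 2 := by
  have h : ∫ l in (1 : ℝ)..√2, l ^ 2 * ghoshRight l =
      ∫ l in (1 : ℝ)..√2, l * (fun s => (1 + s ^ 2) * ghoshTail s) √(l ^ 2 - 1) := by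
    refine integral_congr fun l hl => ?_
    rw [Set.uIcc_of_le one_le_sqrt_two] at hl
    simp only [ghoshRight]
    rw [Real.sq_sqrt (by nlinarith [hl.1])]
    ring
  rw [h, integral_mul_comp_sqrt_sq_sub_one
    (φ := fun s => (1 + s ^ 2) * ghoshTail s) (by have := continuous_ghoshTail; fun_prop) (Φ := fun s =>
    (1 + s ^ 2) ^ 2 / 4 * ghoshTail s + (1 + s ^ 2) ^ 3 / 6 - 2 * (s ^ 5 / 5 + s ^ 3 / 3))]
  · simp only [ghoshTail_one, ghoshTail_zero]
    ring
  · intro s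
    have h1 : HasDerivAt (fun s : ℝ => 1 + s ^ 2) (2 * s) s := by
      simpa using (hasDerivAt_pow 2 s).const_add 1
    refine (((((h1.pow 2).div_const 4).mul (hasDerivAt_ghoshTail s)).add
      ((h1.pow 3).div_const 6)).sub ((((hasDerivAt_pow 5 s).div_const 5).add
        ((hasDerivAt_pow 3 s).div_const 3)).const_mul 2)).congr_deriv ?_
    have hs : 1 + s ^ 2 ≠ 0 := by positivity
    simp only [Pi.pow_apply]
    field_simp
    ring

/-- The contribution of `[1, √2]` to the mean of the Ghosh density. -/
noncomputable def ghoshRightMoment : ℝ := ∫ l in (1 : ℝ)..√2, l * ghoshRight l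

lemma intervalIntegrable_mul_ghoshRight {f : ℝ → ℝ} (hf : Continuous f) (a b : ℝ) :
    IntervalIntegrable (fun l => f l * ghoshRight l) MeasureTheory.volume a b :=
  (hf.mul continuous_ghoshRight).intervalIntegrable a b

lemma integral_mul_ghoshRight_mono {f g : ℝ → ℝ} (hf : Continuous f) (hg : Continuous g)
    (h : ∀ l ∈ Set.Icc 1 √2, f l ≤ g l) :
    ∫ l in (1 : ℝ)..√2, f l * ghoshRight l ≤ ∫ l in (1 : ℝ)..√2, g l * ghoshRight l :=
  integral_mono_on one_le_sqrt_two (intervalIntegrable_mul_ghoshRight hf _ _)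
    (intervalIntegrable_mul_ghoshRight hg _ _)
    fun l hl => mul_le_mul_of_nonneg_right (h l hl) (ghoshRight_nonneg hl)

lemma integral_quadratic_mul_ghoshRight (a b : ℝ) :
    ∫ l in (1 : ℝ)..√2, (a + b * l ^ 2) * ghoshRight l =
      a * (19 / 6 - π) + b * (8 / 5 - π / 2) := by
  simp_rw [add_mul, mul_assoc]
  rw [integral_add, integral_const_mul, integral_const_mul, integral_ghoshRight,
    integral_sq_mul_ghoshRight]
  · exact (continuous_ghoshRight.intervalIntegrable _ _).const_mul a
  · exact (intervalIntegrable_mul_ghoshRight (continuous_pow 2) _ _).const_mul b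

lemma ghoshRightMoment_ge :
    59 / 100 * (19 / 6 - π) + 41 / 100 * (8 / 5 - π / 2) ≤ ghoshRightMoment := by
  rw [← integral_quadratic_mul_ghoshRight]
  refine integral_mul_ghoshRight_mono (by fun_prop) continuous_id fun l hl => ?_
  have h2 : l ≤ 59 / 41 := hl.2.trans (Real.sqrt_le_iff.2 (by norm_num))
  change _ ≤ l
  nlinarith [hl.1, mul_nonneg (sub_nonneg.2 hl.1) (sub_nonneg.2 h2)]

lemma ghoshRightMoment_le :
    ghoshRightMoment ≤ 1 / 2 * (19 / 6 - π) + 1 / 2 * (8 / 5 - π / 2) := by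
  rw [← integral_quadratic_mul_ghoshRight]
  refine integral_mul_ghoshRight_mono continuous_id (by fun_prop) fun l hl => ?_
  nlinarith [sq_nonneg (l - 1)]

/-- The distribution function of the Ghosh density on `[0, 1]`. -/
noncomputable def ghoshLeftCDF (x : ℝ) : ℝ := π * x ^ 2 - 8 / 3 * x ^ 3 + x ^ 4 / 2

/-- The partial first moment of the Ghosh density on `[0, 1]`. -/
noncomputable def ghoshLeftMoment (x : ℝ) : ℝ := 2 / 3 * π * x ^ 3 - 2 * x ^ 4 + 2 / 5 * x ^ 5

lemma hasDerivAt_ghoshLeftCDF (x : ℝ) : HasDerivAt ghoshLeftCDF (ghoshLeft x) x := by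
  refine ((((hasDerivAt_pow 2 x).const_mul π).sub ((hasDerivAt_pow 3 x).const_mul (8 / 3))).add
    ((hasDerivAt_pow 4 x).div_const 2)).congr_deriv ?_
  simp only [ghoshLeft]
  push_cast
  ring

lemma hasDerivAt_ghoshLeftMoment (x : ℝ) :
    HasDerivAt ghoshLeftMoment (x * ghoshLeft x) x := by
  refine ((((hasDerivAt_pow 3 x).const_mul (2 / 3 * π)).sub
    ((hasDerivAt_pow 4 x).const_mul 2)).add
    ((hasDerivAt_pow 5 x).const_mul (2 / 5))).congr_deriv ?_
  simp only [ghoshLeft]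
  push_cast
  ring

lemma integral_ghoshLeft (a b : ℝ) :
    ∫ l in a..b, ghoshLeft l = ghoshLeftCDF b - ghoshLeftCDF a :=
  integral_eq_sub_of_hasDerivAt (fun l _ => hasDerivAt_ghoshLeftCDF l)
    (continuous_ghoshLeft.intervalIntegrable _ _)

lemma integral_mul_ghoshLeft (a b : ℝ) :
    ∫ l in a..b, l * ghoshLeft l = ghoshLeftMoment b - ghoshLeftMoment a :=
  integral_eq_sub_of_hasDerivAt (fun l _ => hasDerivAt_ghoshLeftMoment l)
    ((continuous_id.mul continuous_ghoshLeft).intervalIntegrable _ _)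

lemma integral_max_mul_ghoshLeft {x : ℝ} (h0 : 0 ≤ x) (h1 : x ≤ 1) :
    ∫ l in (0 : ℝ)..1, max x l * ghoshLeft l =
      x * ghoshLeftCDF x + (ghoshLeftMoment 1 - ghoshLeftMoment x) := by
  have hc : Continuous fun l => max x l * ghoshLeft l :=
    (continuous_const.max continuous_id).mul continuous_ghoshLeft
  rw [← integral_add_adjacent_intervals (hc.intervalIntegrable 0 x) (hc.intervalIntegrable x 1)]
  congr 1
  · calc _ = ∫ l in (0 : ℝ)..x, x * ghoshLeft l := by
          refine integral_congr fun l hl => ?_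
          rw [Set.uIcc_of_le h0] at hl
          simp only [max_eq_left hl.2]
      _ = _ := by
          rw [integral_const_mul, integral_ghoshLeft]
          simp [ghoshLeftCDF]
  · rw [← integral_mul_ghoshLeft]
    refine integral_congr fun l hl => ?_
    rw [Set.uIcc_of_le h1] at hl
    simp only [max_eq_right hl.1]

/-- An integral against the Ghosh density splits at the point `1`. -/
lemma integral_mul_ghoshDensity {f g : ℝ → ℝ} (hf : Continuous f) (hg : Continuous g) {k : ℝ → ℝ}
    (hkf : ∀ l ∈ Set.Icc (0 : ℝ) 1, k l = f l) (hkg : ∀ l ∈ Set.Icc 1 √2, k l = g l) :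
    ∫ l in (0 : ℝ)..√2, k l * ghoshDensity l =
      (∫ l in (0 : ℝ)..1, f l * ghoshLeft l) + ∫ l in (1 : ℝ)..√2, g l * ghoshRight l := by
  have hl : Set.EqOn (fun l => k l * ghoshDensity l) (fun l => f l * ghoshLeft l)
      (Set.uIcc 0 1) := fun l hl => by
    rw [Set.uIcc_of_le zero_le_one] at hl
    simp only [hkf l hl, ghoshDensity_eq_left hl.1 hl.2]
  have hr : Set.EqOn (fun l => k l * ghoshDensity l) (fun l => g l * ghoshRight l)
      (Set.uIcc 1 √2) := fun l hl => by
    rw [Set.uIcc_of_le one_le_sqrt_two] at hl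
    simp only [hkg l hl, ghoshDensity_eq_right hl.1 hl.2]
  rw [← integral_congr hl, ← integral_congr hr, integral_add_adjacent_intervals]
  · exact (((hf.mul continuous_ghoshLeft).continuousOn).congr hl).intervalIntegrable
  · exact (((hg.mul continuous_ghoshRight).continuousOn).congr hr).intervalIntegrable

/-- The contribution of `[1, √2]` to the mean of `max x l`. -/
noncomputable def ghoshRightMax (x : ℝ) : ℝ := ∫ l in (1 : ℝ)..√2, max x l * ghoshRight l

lemma continuous_ghoshRightMax : Continuous ghoshRightMax := by
  refine continuous_parametric_intervalIntegral_of_continuous' ?_ _ _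
  have := continuous_ghoshRight
  fun_prop

lemma ghoshRightMax_ge {x : ℝ} : x * (19 / 6 - π) ≤ ghoshRightMax x := by
  rw [← integral_ghoshRight, ← integral_const_mul]
  exact integral_mul_ghoshRight_mono continuous_const (by fun_prop) fun l _ => le_max_left x l

lemma ghoshRightMax_le {x : ℝ} (h : 1 ≤ x) : ghoshRightMax x ≤ x * ghoshRightMoment := by
  rw [ghoshRightMoment, ← integral_const_mul]
  simp_rw [← mul_assoc]
  refine integral_mul_ghoshRight_mono (by fun_prop) (by fun_prop) fun l hl => ?_
  exact max_le (by nlinarith [hl.1]) (by nlinarith [hl.1])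

lemma ghoshLeftCDF_one : ghoshLeftCDF 1 = π - 13 / 6 := by
  simp only [ghoshLeftCDF]; ring

lemma integral_max_mul_ghoshDensity_left {x : ℝ} (hx : x ∈ Set.Icc (0 : ℝ) 1) :
    ∫ l in (0 : ℝ)..√2, max x l * ghoshDensity l =
      x * ghoshLeftCDF x + (ghoshLeftMoment 1 - ghoshLeftMoment x) + ghoshRightMoment := by
  have hc : Continuous fun l : ℝ => max x l := by fun_prop
  rw [integral_mul_ghoshDensity hc continuous_id (fun _ _ => rfl)
    fun l hl => max_eq_right (hx.2.trans hl.1), integral_max_mul_ghoshLeft hx.1 hx.2]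
  rfl

lemma integral_max_mul_ghoshDensity_right {x : ℝ} (hx : x ∈ Set.Icc 1 √2) :
    ∫ l in (0 : ℝ)..√2, max x l * ghoshDensity l =
      x * (π - 13 / 6) + ghoshRightMax x := by
  have hc : Continuous fun l : ℝ => max x l := by fun_prop
  rw [integral_mul_ghoshDensity (continuous_const (y := x)) hc
    (fun l hl => max_eq_left (hl.2.trans hx.1)) (fun _ _ => rfl), integral_const_mul,
    integral_ghoshLeft, ghoshLeftCDF_one]
  simp [ghoshLeftCDF, ghoshRightMax]

/-- The part of the expected maximum where the first length is at most `1`. -/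
lemma integral_left_expected_max :
    ∫ x in (0 : ℝ)..1, (x * ghoshLeftCDF x + (ghoshLeftMoment 1 - ghoshLeftMoment x) +
        ghoshRightMoment) * ghoshLeft x =
      4 / 5 * π ^ 2 - 226 / 63 * π + 251 / 63 + ghoshRightMoment * (π - 13 / 6) := by
  rw [integral_eq_sub_of_hasDerivAt (f := fun x =>
    (ghoshLeftMoment 1 - ghoshLeftMoment x) * ghoshLeftCDF x + ghoshRightMoment * ghoshLeftCDF x +
      (4 / 5 * π ^ 2 * x ^ 5 - 40 / 9 * π * x ^ 6 + (6 / 7 * π + 128 / 21) * x ^ 7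
        - 7 / 3 * x ^ 8 + 2 / 9 * x ^ 9))]
  · simp only [ghoshLeftCDF_one]
    simp only [ghoshLeftCDF]
    ring
  · intro x _
    have hF := hasDerivAt_ghoshLeftCDF x
    have hp : ∀ (n : ℕ) (c : ℝ), HasDerivAt (fun x : ℝ => c * x ^ n) (c * (n * x ^ (n - 1))) x :=
      fun n c => (hasDerivAt_pow n x).const_mul c
    refine (((((hasDerivAt_ghoshLeftMoment x).const_sub _).mul hF).add (hF.const_mul _)).add
      (((((hp 5 _).sub (hp 6 _)).add (hp 7 _)).sub (hp 8 _)).add (hp 9 _))).congr_deriv ?_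
    simp only [ghoshLeft, ghoshLeftCDF]
    push_cast
    ring
  · refine Continuous.intervalIntegrable ?_ _ _
    unfold ghoshLeftCDF ghoshLeftMoment ghoshLeft
    fun_prop

lemma expected_max_eq :
    (∫ l₁ in (0 : ℝ)..√2, ∫ l₂ in (0 : ℝ)..√2, max l₁ l₂ * ghoshDensity l₁ * ghoshDensity l₂) =
      4 / 5 * π ^ 2 - 226 / 63 * π + 251 / 63 + 2 * ghoshRightMoment * (π - 13 / 6) +
        ∫ x in (1 : ℝ)..√2, ghoshRightMax x * ghoshRight x := by
  have hR := continuous_ghoshRightMax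
  have hp := continuous_ghoshRight
  have hf : Continuous fun x => x * ghoshLeftCDF x + (ghoshLeftMoment 1 - ghoshLeftMoment x) +
      ghoshRightMoment := by
    unfold ghoshLeftCDF ghoshLeftMoment
    fun_prop
  have hg : Continuous fun x => x * (π - 13 / 6) + ghoshRightMax x := by fun_prop
  have hcomm : ∀ x, ∫ l in (0 : ℝ)..√2, max x l * ghoshDensity x * ghoshDensity l =
      (∫ l in (0 : ℝ)..√2, max x l * ghoshDensity l) * ghoshDensity x := fun x => by
    rw [← integral_mul_const]
    exact integral_congr fun l _ => mul_right_comm _ _ _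
  simp_rw [hcomm]
  rw [integral_mul_ghoshDensity hf hg (fun _ => integral_max_mul_ghoshDensity_left)
    (fun _ => integral_max_mul_ghoshDensity_right), integral_left_expected_max]
  have hadd : ∀ x, (x * (π - 13 / 6) + ghoshRightMax x) * ghoshRight x =
      x * ghoshRight x * (π - 13 / 6) + ghoshRightMax x * ghoshRight x := fun x => by ring
  simp_rw [hadd]
  rw [integral_add, integral_mul_const, ← ghoshRightMoment]
  · ring
  · exact Continuous.intervalIntegrable (by fun_prop) _ _
  · exact Continuous.intervalIntegrable (by fun_prop) _ _

lemma integral_ghoshRightMax_ge :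
    0 ≤ ∫ x in (1 : ℝ)..√2, ghoshRightMax x * ghoshRight x := by
  have h : 0 ≤ 19 / 6 - π := by linarith [pi_lt_d2]
  refine integral_nonneg one_le_sqrt_two fun x hx => mul_nonneg ?_ (ghoshRight_nonneg hx)
  exact (mul_nonneg (by linarith [hx.1]) h).trans ghoshRightMax_ge

lemma integral_ghoshRightMax_le :
    ∫ x in (1 : ℝ)..√2, ghoshRightMax x * ghoshRight x ≤ ghoshRightMoment ^ 2 := by
  have h : ∫ x in (1 : ℝ)..√2, x * ghoshRightMoment * ghoshRight x = ghoshRightMoment ^ 2 := by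
    simp_rw [mul_right_comm _ ghoshRightMoment]
    rw [integral_mul_const, ← ghoshRightMoment, sq]
  rw [← h]
  exact integral_mul_ghoshRight_mono continuous_ghoshRightMax (by fun_prop)
    fun x hx => ghoshRightMax_le hx.1

/-- The expected maximum of two independent lengths distributed according to the
Ghosh density lies strictly between `0.66` and `0.67` (the paper computes `≈ 0.663`). -/
theorem stmt_5 :
    0.66 < (∫ l₁ in (0:ℝ)..(Real.sqrt 2), ∫ l₂ in (0:ℝ)..(Real.sqrt 2),
        max l₁ l₂ * ghoshDensity l₁ * ghoshDensity l₂) ∧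
    (∫ l₁ in (0:ℝ)..(Real.sqrt 2), ∫ l₂ in (0:ℝ)..(Real.sqrt 2),
        max l₁ l₂ * ghoshDensity l₁ * ghoshDensity l₂) < 0.67 := by
  rw [expected_max_eq]
  have h1 := ghoshRightMoment_ge
  have h2 := ghoshRightMoment_le
  have h3 := integral_ghoshRightMax_ge
  have h4 := integral_ghoshRightMax_le
  have p1 := pi_gt_d6
  have p2 := pi_lt_d6
  have m1 : 0.0267 ≤ ghoshRightMoment := by linarith
  have m2 : ghoshRightMoment ≤ 0.0272 := by linarith
  constructor
  · have : 0.0267 * (3.141592 - 13 / 6) ≤ ghoshRightMoment * (π - 13 / 6) :=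
      mul_le_mul m1 (by linarith) (by norm_num) (by linarith)
    nlinarith
  · have : ghoshRightMoment * (π - 13 / 6) ≤ 0.0272 * (3.141593 - 13 / 6) :=
      mul_le_mul m2 (by linarith) (by linarith) (by norm_num)
    nlinarith
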